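/- arXiv:2311.04406 — 5 statements merged into one kernel-verified Lean document; each statement's English description precedes it below -/
import Mathlib

section
/- Let k ≥ 1, s ≥ 1, T1 ≥ 1, T3 ≥ 1 be natural numbers, and let e : Fin T1 → Fin T3 → ℤ be a fixed matrix of integers such that not all entries are zero modulo 2^k (i.e., there exist i, j with ¬ 2^k ∣ e i j). For a tuple (α, χ, χ̂) with α ∈ {0,…,2^s−1}, χ : Fin T3 → {0,…,2^s−1}, χ̂ : Fin T1 → {0,…,2^s−1}, define G i := (∑_{j} α · e i j · χ j) mod 2^{k+s} (the representative in [0, 2^{k+s})). Then the number of tuples (α, χ, χ̂) ∈ {0,…,2^s−1} × {0,…,2^s−1}^{T3} × {0,…,2^s−1}^{T1} satisfying 2^{k+2s} ∣ ∑_{i} χ̂ i · G i is at most (s+1) · 2^{s·(T1+T3+1) − s}. Equivalently, when α, all χ j, and all χ̂ i are sampled independently and uniformly from ℤ_{2^s}, the probability that ∑_{i} χ̂ i · (∑_{j} α · e i j · χ j mod 2^{k+s}) ≡ 0 (mod 2^{k+2s}) is at most (s+1)·2^{−s} = 2^{−s+log₂(s+1)}. -/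
theorem pow_dvd_or_pow_dvd_of_pow_add_dvd_mul {p : ℤ} (hp : Prime p) (m n : ℕ) {a b : ℤ}
    (h : p ^ (m + n) ∣ a * b) : p ^ m ∣ a ∨ p ^ n ∣ b := by
  induction m generalizing a with
  | zero => simp
  | succ m ih =>
    by_cases ha : p ∣ a
    · obtain ⟨c, rfl⟩ := ha
      rw [show m + 1 + n = m + n + 1 by ring, pow_succ', mul_assoc,
        mul_dvd_mul_iff_left hp.ne_zero] at h
      refine (ih h).imp_left fun hc => ?_
      rw [pow_succ']
      exact mul_dvd_mul_left p hc
    · exact Or.inr ((pow_dvd_pow p (by omega)).trans (hp.pow_dvd_of_dvd_mul_left _ ha h))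

/-- A set of residues in `{0, …, D * B - 1}` that are pairwise congruent modulo `D` has at most
`B` elements. -/
theorem card_le_of_pairwise_modEq {N D B : ℕ} (hN : N = D * B) (S : Finset (Fin N))
    (h : ∀ x ∈ S, ∀ y ∈ S, (D : ℤ) ∣ ((x.val : ℤ) - y.val)) : S.card ≤ B := by
  have hmaps : ∀ x ∈ S, x.val / D ∈ Finset.range B := fun x _ =>
    Finset.mem_range.2 (Nat.div_lt_of_lt_mul (hN ▸ x.isLt))
  have hinj : Set.InjOn (fun x : Fin N => x.val / D) S := by
    intro x hx y hy hxy
    have hmod : x.val % D = y.val % D := 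
      (Nat.modEq_iff_dvd.2 (h x hx y hy)).symm
    have hdiv : x.val / D = y.val / D := hxy
    apply Fin.ext
    rw [← Nat.div_add_mod x.val D, ← Nat.div_add_mod y.val D, hmod, hdiv]
  simpa using Finset.card_le_card_of_injOn _ hmaps hinj

theorem card_filter_dvd_mul_linear_le (k s α : ℕ) {a : ℤ} (ha : ¬ (2 : ℤ) ^ k ∣ a) (c : ℤ) :
    (Finset.univ.filter fun x : Fin (2 ^ s) =>
      (2 : ℤ) ^ (k + s) ∣ α * (a * (x.val : ℤ) + c)).card ≤ Nat.gcd α (2 ^ s) := by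
  have hg : 0 < Nat.gcd α (2 ^ s) := Nat.gcd_pos_of_pos_right _ (by positivity)
  set g := Nat.gcd α (2 ^ s) with hgdef
  have hD : 2 ^ s = 2 ^ s / g * g := (Nat.div_mul_cancel (Nat.gcd_dvd_right _ _)).symm
  have hA : α = α / g * g := (Nat.div_mul_cancel (Nat.gcd_dvd_left _ _)).symm
  refine card_le_of_pairwise_modEq (D := 2 ^ s / g) hD _ fun x hx y hy => ?_
  simp only [Finset.mem_filter, Finset.mem_univ, true_and] at hx hy
  have hsub : (2 : ℤ) ^ (k + s) ∣ a * (α * ((x.val : ℤ) - y.val)) := by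
    have h := dvd_sub hx hy
    rwa [show (α : ℤ) * (a * x.val + c) - α * (a * y.val + c) = a * (α * (x.val - y.val)) by ring]
      at h
  have hdvd := (pow_dvd_or_pow_dvd_of_pow_add_dvd_mul Int.prime_two k s hsub).resolve_left ha
  have hcop : IsCoprime ((2 ^ s / g : ℕ) : ℤ) ((α / g : ℕ) : ℤ) :=
    Nat.isCoprime_iff_coprime.2 (Nat.coprime_div_gcd_div_gcd hg).symm
  refine hcop.dvd_of_dvd_mul_left ?_
  have hg' : (g : ℤ) ≠ 0 := by exact_mod_cast hg.ne'
  rw [← mul_dvd_mul_iff_right hg']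
  have h1 : (2 : ℤ) ^ s = ((2 ^ s / g : ℕ) : ℤ) * g := by exact_mod_cast hD
  have h2 : (α : ℤ) = ((α / g : ℕ) : ℤ) * g := by exact_mod_cast hA
  rwa [h1, h2, mul_right_comm] at hdvd

theorem card_filter_dvd_linear_le_one (m s : ℕ) {a : ℤ} (ha : ¬ (2 : ℤ) ^ m ∣ a) (c : ℤ) :
    (Finset.univ.filter fun x : Fin (2 ^ s) =>
      (2 : ℤ) ^ (m + s) ∣ a * (x.val : ℤ) + c).card ≤ 1 := by
  simpa using card_filter_dvd_mul_linear_le m s 1 ha c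

theorem two_mul_sum_gcd_two_pow (s : ℕ) :
    2 * ∑ a ∈ Finset.range (2 ^ s), Nat.gcd a (2 ^ s) = (s + 2) * 2 ^ s := by
  induction s with
  | zero => simp
  | succ s ih =>
    have hsplit : ∀ (f : ℕ → ℕ) (n : ℕ), ∑ a ∈ Finset.range (2 * n), f a =
        ∑ b ∈ Finset.range n, (f (2 * b) + f (2 * b + 1)) := by
      intro f n
      induction n with
      | zero => simp
      | succ n ihn =>
        rw [Finset.sum_range_succ, ← ihn, mul_add, mul_one, Finset.sum_range_succ,
          Finset.sum_range_succ, add_assoc]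
    have hodd : ∀ b : ℕ, Nat.gcd (2 * b + 1) (2 * 2 ^ s) = 1 := fun b => by
      rw [← pow_succ']
      exact Nat.Coprime.pow_right _ (by simp)
    rw [pow_succ', hsplit]
    simp only [Nat.gcd_mul_left, hodd, Finset.sum_add_distrib, ← Finset.mul_sum,
      Finset.sum_const, Finset.card_range, smul_eq_mul, mul_one]
    rw [mul_add, ih]
    ring

/-- If fixing all coordinates but the `i`-th leaves at most `B` solutions of `P`, then `P` has at
most `B * (card β) ^ n` solutions. -/
theorem card_filter_le_of_insertNth {β : Type*} [Fintype β] [DecidableEq β] {n : ℕ}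
    (i : Fin (n + 1)) (P : (Fin (n + 1) → β) → Prop) [DecidablePred P] (B : ℕ)
    (h : ∀ g : Fin n → β,
      (Finset.univ.filter fun x => P (i.insertNth (α := fun _ => β) x g)).card ≤ B) :
    (Finset.univ.filter P).card ≤ B * Fintype.card β ^ n := by
  have hfib : ∀ g ∈ (Finset.univ.filter P).image i.removeNth,
      ((Finset.univ.filter P).filter fun f => i.removeNth f = g).card ≤ B := by
    intro g _
    refine le_trans (Finset.card_le_card_of_injOn (fun f => f i) ?_ ?_) (h g)
    · intro f hf
      simp only [Finset.coe_filter, Finset.mem_filter, Finset.mem_univ, true_and,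
        Set.mem_ofPred_eq] at hf ⊢
      obtain ⟨hP, rfl⟩ := hf
      simpa using hP
    · intro f hf f' hf' hff
      simp only [Finset.coe_filter, Finset.mem_filter, Finset.mem_univ, true_and,
        Set.mem_ofPred_eq] at hf hf'
      rw [← Fin.insertNth_self_removeNth i f, ← Fin.insertNth_self_removeNth i f', hf.2, hf'.2]
      exact congrArg (fun x => i.insertNth (α := fun _ => β) x g) hff
  refine (Finset.card_le_mul_card_image _ B hfib).trans (Nat.mul_le_mul_left B ?_)
  refine (Finset.card_le_univ _).trans ?_
  simp

theorem card_filter_dvd_mul_sum_le (k s n α : ℕ) (v : Fin (n + 1) → ℤ)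
    (hv : ∃ j, ¬ (2 : ℤ) ^ k ∣ v j) :
    (Finset.univ.filter fun χ : Fin (n + 1) → Fin (2 ^ s) =>
      (2 : ℤ) ^ (k + s) ∣ ∑ j, (α : ℤ) * v j * ((χ j).val : ℤ)).card
      ≤ Nat.gcd α (2 ^ s) * (2 ^ s) ^ n := by
  obtain ⟨j, hj⟩ := hv
  have := card_filter_le_of_insertNth (β := Fin (2 ^ s)) j
    (fun χ => (2 : ℤ) ^ (k + s) ∣ ∑ j, (α : ℤ) * v j * ((χ j).val : ℤ)) (Nat.gcd α (2 ^ s)) ?_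
  · simpa using this
  · intro g
    refine le_trans (le_of_eq ?_) (card_filter_dvd_mul_linear_le k s α hj
      (∑ l, v (j.succAbove l) * ((g l).val : ℤ)))
    congr 1
    refine Finset.filter_congr fun x _ => ?_
    rw [Fin.sum_univ_succAbove _ j]
    simp only [Fin.insertNth_apply_same, Fin.insertNth_apply_succAbove, mul_add, Finset.mul_sum,
      mul_assoc]

theorem card_filter_dvd_sum_mul_le (m s n : ℕ) (G : Fin (n + 1) → ℤ) (i : Fin (n + 1))
    (hi : ¬ (2 : ℤ) ^ m ∣ G i) :
    (Finset.univ.filter fun χ : Fin (n + 1) → Fin (2 ^ s) =>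
      (2 : ℤ) ^ (m + s) ∣ ∑ i, ((χ i).val : ℤ) * G i).card ≤ (2 ^ s) ^ n := by
  have := card_filter_dvd_mul_sum_le m s n 1 G ⟨i, hi⟩
  simpa [mul_comm] using this


/-- Theorem 1 (checksum soundness): if the error matrix `e` is not all zero
modulo `2^k`, then the number of tuples `(α, χ, χ̂)` with entries uniform in
`{0, …, 2^s − 1}` for which the checksum
`∑ i, χ̂ i * ((∑ j, α * e i j * χ j) mod 2^(k+s))` vanishes modulo `2^(k+2s)`
is at most `(s+1) * 2^(s*(T1+T3+1) − s)`, i.e. the probability is at most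
`(s+1) * 2^(−s)`. -/
theorem checksum_soundness (k s T1 T3 : ℕ) (hk : 1 ≤ k) (hs : 1 ≤ s)
    (hT1 : 1 ≤ T1) (hT3 : 1 ≤ T3) (e : Fin T1 → Fin T3 → ℤ)
    (he : ∃ i j, ¬ ((2 : ℤ) ^ k ∣ e i j)) :
    ((Finset.univ :
        Finset (Fin (2 ^ s) × (Fin T3 → Fin (2 ^ s)) × (Fin T1 → Fin (2 ^ s)))).filter
      (fun t =>
        (2 : ℤ) ^ (k + 2 * s) ∣
          ∑ i, ((t.2.2 i).val : ℤ) *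
            ((∑ j, ((t.1).val : ℤ) * e i j * ((t.2.1 j).val : ℤ)) % 2 ^ (k + s)))).card
      ≤ (s + 1) * 2 ^ (s * (T1 + T3 + 1) - s) := by
  classical
  obtain ⟨m, rfl⟩ : ∃ m, T1 = m + 1 := ⟨T1 - 1, by omega⟩
  obtain ⟨n, rfl⟩ : ∃ n, T3 = n + 1 := ⟨T3 - 1, by omega⟩
  obtain ⟨i, hij⟩ := he
  have hexp : s * (m + 1 + (n + 1) + 1) - s = s * (m + n + 2) := by
    rw [Nat.sub_eq_iff_eq_add (Nat.le_mul_of_pos_right s (by omega))]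
    ring
  rw [hexp]
  obtain rfl | hs2 : s = 1 ∨ 2 ≤ s := by omega
  · refine (Finset.card_le_univ _).trans (le_of_eq ?_)
    simp only [Fintype.card_prod, Fintype.card_fun, Fintype.card_fin]
    ring
  have hgcd : ∑ a : Fin (2 ^ s), Nat.gcd a.val (2 ^ s) ≤ s * 2 ^ s := by
    have h := two_mul_sum_gcd_two_pow s
    rw [← Fin.sum_univ_eq_sum_range (fun a => Nat.gcd a (2 ^ s))] at h
    nlinarith [Nat.mul_le_mul_right (2 ^ s) (show s + 2 ≤ 2 * s by omega)]
  have hinner : ∀ (a : Fin (2 ^ s)) (χ : Fin (n + 1) → Fin (2 ^ s)),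
      (Finset.univ.filter fun χ' : Fin (m + 1) → Fin (2 ^ s) =>
        (2 : ℤ) ^ (k + 2 * s) ∣ ∑ i, ((χ' i).val : ℤ) *
          ((∑ j, (a.val : ℤ) * e i j * ((χ j).val : ℤ)) % 2 ^ (k + s))).card
      ≤ (if (2 : ℤ) ^ (k + s) ∣ ∑ j, (a.val : ℤ) * e i j * ((χ j).val : ℤ) then 1 else 0)
          * (2 ^ s) ^ (m + 1) + (2 ^ s) ^ m := by
    intro a χ
    split_ifs with h
    · refine (Finset.card_le_univ _).trans ?_
      simp
    · rw [zero_mul, zero_add, show k + 2 * s = k + s + s by ring]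
      refine card_filter_dvd_sum_mul_le (k + s) s m _ i fun h' => h ?_
      exact (Int.dvd_iff_emod_eq_zero).2 (by simpa using Int.emod_eq_zero_of_dvd h')
  have houter : ∀ a : Fin (2 ^ s),
      ∑ χ : Fin (n + 1) → Fin (2 ^ s),
        (if (2 : ℤ) ^ (k + s) ∣ ∑ j, (a.val : ℤ) * e i j * ((χ j).val : ℤ) then 1 else 0)
      ≤ Nat.gcd a.val (2 ^ s) * (2 ^ s) ^ n := by
    intro a
    rw [← Finset.card_filter]
    exact card_filter_dvd_mul_sum_le k s n a.val (e i) hij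
  simp_rw [Finset.card_filter, Fintype.sum_prod_type, ← Finset.card_filter]
  calc _ ≤ ∑ a : Fin (2 ^ s), ∑ χ : Fin (n + 1) → Fin (2 ^ s), _ :=
        Finset.sum_le_sum fun a _ => Finset.sum_le_sum fun χ _ => hinner a χ
    _ ≤ ∑ a : Fin (2 ^ s), (Nat.gcd a.val (2 ^ s) * (2 ^ s) ^ n * (2 ^ s) ^ (m + 1)
          + (2 ^ s) ^ (n + 1) * (2 ^ s) ^ m) := by
        refine Finset.sum_le_sum fun a _ => ?_
        rw [Finset.sum_add_distrib, ← Finset.sum_mul]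
        refine add_le_add (Nat.mul_le_mul_right _ (houter a)) (le_of_eq ?_)
        simp
    _ = (∑ a : Fin (2 ^ s), Nat.gcd a.val (2 ^ s)) * ((2 ^ s) ^ n * (2 ^ s) ^ (m + 1))
          + 2 ^ s * ((2 ^ s) ^ (n + 1) * (2 ^ s) ^ m) := by
        rw [Finset.sum_add_distrib, Finset.sum_mul]
        simp [mul_assoc]
    _ ≤ s * 2 ^ s * ((2 ^ s) ^ n * (2 ^ s) ^ (m + 1))
          + 2 ^ s * ((2 ^ s) ^ (n + 1) * (2 ^ s) ^ m) :=
        Nat.add_le_add_right (Nat.mul_le_mul_right _ hgcd) _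
    _ = (s + 1) * 2 ^ (s * (m + n + 2)) := by
        rw [pow_mul]
        ring
end

section
/- Let k ≥ 0, s ≥ 1, and T1 ≥ 1 be natural numbers, and let y : Fin T1 → ℤ be fixed integers with 0 ≤ y i < 2^{k+s} for every i, such that not all y i are zero (i.e., there exists i with y i ≠ 0). Then the number of tuples χ̂ ∈ {0,…,2^s−1}^{T1} satisfying 2^{k+2s} ∣ ∑_{i} χ̂ i · y i is at most 2^{s·(T1−1)}. Equivalently, when χ̂_1,…,χ̂_{T1} are sampled independently and uniformly from {0,…,2^s−1}, the probability that ∑_{i} χ̂_i · y_i ≡ 0 (mod 2^{k+2s}) is at most 2^{−s}. -/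
/-- If `0 < |y| < b` and `a, a' ∈ [0, m)`, then `a * y ≡ a' * y (mod m * b)` forces `a = a'`. -/
lemma eq_of_mul_dvd_sub_mul {m a a' : ℕ} {b y : ℤ} (ha : a < m) (ha' : a' < m)
    (hy : |y| < b) (hy0 : y ≠ 0) (h : (m : ℤ) * b ∣ ((a : ℤ) - a') * y) : a = a' := by
  have hsub : |(a : ℤ) - a'| < m := by
    rw [abs_lt]
    omega
  have hlt : |((a : ℤ) - a') * y| < m * b := by
    rw [abs_mul]
    exact mul_lt_mul'' hsub hy (abs_nonneg _) (abs_nonneg _)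
  have hzero := (mul_eq_zero.mp (Int.eq_zero_of_abs_lt_dvd h hlt)).resolve_right hy0
  omega

/-- Lemma 1: if `y i ∈ [0, 2^(k+s))` are not all zero, then the number of
tuples `χ̂ ∈ {0,…,2^s−1}^{T1}` with `∑ i, χ̂ i * y i ≡ 0 (mod 2^(k+2s))` is at
most `2^(s*(T1−1))`, i.e. the probability over uniform `χ̂` is at most `2^(−s)`. -/
theorem lemma1_count (k s T1 : ℕ) (hs : 1 ≤ s) (hT1 : 1 ≤ T1)
    (y : Fin T1 → ℤ) (hy : ∀ i, 0 ≤ y i ∧ y i < 2 ^ (k + s))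
    (hne : ∃ i, y i ≠ 0) :
    ((Finset.univ : Finset (Fin T1 → Fin (2 ^ s))).filter
      (fun χhat => (2 : ℤ) ^ (k + 2 * s) ∣ ∑ i, ((χhat i).val : ℤ) * y i)).card
      ≤ 2 ^ (s * (T1 - 1)) := by
  obtain ⟨j, hj⟩ := hne
  obtain ⟨n, rfl⟩ := Nat.exists_eq_add_of_le' hT1
  have hcard : (Finset.univ : Finset (Fin n → Fin (2 ^ s))).card = 2 ^ (s * (n + 1 - 1)) := by
    simp [pow_mul]
  rw [← hcard]
  refine Finset.card_le_card_of_injOn (fun χ => j.removeNth χ) (fun _ _ => by simp) ?_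
  intro χ hχ χ' hχ' hrem
  simp only [Finset.coe_filter, Finset.mem_univ, true_and, Set.mem_ofPred_eq] at hχ hχ'
  have hother : ∀ i, χ (j.succAbove i) = χ' (j.succAbove i) := fun i => congrFun hrem i
  have hdvd := dvd_sub hχ hχ'
  rw [Fin.sum_univ_succAbove _ j, Fin.sum_univ_succAbove _ j] at hdvd
  simp only [hother, add_sub_add_right_eq_sub, ← sub_mul] at hdvd
  have hpow : (2 : ℤ) ^ (k + 2 * s) = ((2 ^ s : ℕ) : ℤ) * 2 ^ (k + s) := by
    push_cast
    ring
  rw [hpow] at hdvd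
  have hjj : χ j = χ' j := Fin.ext <| eq_of_mul_dvd_sub_mul (χ j).isLt (χ' j).isLt
    (by rw [abs_of_nonneg (hy j).1]; exact (hy j).2) hj hdvd
  funext i
  exact Fin.succAboveCases j hjj hother i
end

section
/- Let k ≥ 1, s ≥ 1, and T3 ≥ 1 be natural numbers, let e : Fin T3 → ℤ be fixed integers such that not all e i are zero modulo 2^k (i.e., there exists i with ¬ 2^k ∣ e i), and let y ∈ ℤ be arbitrary. Then the number of tuples (α, χ) ∈ {0,…,2^s−1} × {0,…,2^s−1}^{T3} satisfying 2^{k+s} ∣ (∑_{i} α · e i · χ i − y) is at most (s+1) · 2^{s·T3}. Equivalently, when α and χ_1,…,χ_{T3} are sampled independently and uniformly from {0,…,2^s−1}, the probability that ∑_{i} α·e_i·χ_i ≡ y (mod 2^{k+s}) is at most (s+1)·2^{−s} = 2^{−s+log₂(s+1)}. -/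
/-- If `p ^ k ∤ a`, then `a` can absorb fewer than `k` factors of `p`. -/
theorem Prime.pow_dvd_of_pow_add_dvd_mul {p a b : ℤ} (hp : Prime p) {k s : ℕ}
    (ha : ¬ p ^ k ∣ a) (h : p ^ (k + s) ∣ a * b) : p ^ s ∣ b := by
  by_contra hb
  have hlt₁ := emultiplicity_lt_iff_not_dvd.mpr ha
  have hlt₂ := emultiplicity_lt_iff_not_dvd.mpr hb
  have hle := le_emultiplicity_of_pow_dvd h
  rw [emultiplicity_mul hp] at hle
  lift emultiplicity p a to ℕ using hlt₁.ne_top with m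
  lift emultiplicity p b to ℕ using hlt₂.ne_top with n
  norm_cast at hlt₁ hlt₂ hle
  omega

/-- Residues `x, x' < n` with `n ∣ a * (x - x')` agree once their quotients by
`n / gcd a n` agree. -/
theorem eq_of_dvd_mul_sub_of_div_eq {n a x x' : ℕ} (hn : 0 < n)
    (h : (n : ℤ) ∣ a * ((x : ℤ) - x'))
    (hdiv : x / (n / a.gcd n) = x' / (n / a.gcd n)) : x = x' := by
  have hg : 0 < a.gcd n := Nat.gcd_pos_of_pos_right _ hn
  have hmod : a * x' ≡ a * x [MOD n] := by
    rw [Nat.modEq_iff_dvd]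
    push_cast
    rwa [← mul_sub]
  have hmod' : x' ≡ x [MOD n / n.gcd a] := hmod.cancel_left_div_gcd hn
  rw [Nat.gcd_comm] at hmod'
  rw [← Nat.div_add_mod x (n / a.gcd n), ← Nat.div_add_mod x' (n / a.gcd n), hdiv, hmod']

/-- Pillai's function at a power of two. -/
theorem sum_gcd_two_pow_le (s : ℕ) :
    ∑ a : Fin (2 ^ s), (a : ℕ).gcd (2 ^ s) ≤ (s + 1) * 2 ^ s := by
  rw [Fin.sum_univ_eq_sum_range (fun a => a.gcd (2 ^ s))]
  calc ∑ a ∈ Finset.range (2 ^ s), a.gcd (2 ^ s)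
      ≤ ∑ a ∈ Finset.range (2 ^ s), ∑ j ∈ Finset.range (s + 1),
          if a ≡ 0 [MOD 2 ^ j] then 2 ^ j else 0 := by
        refine Finset.sum_le_sum fun a _ => ?_
        obtain ⟨j, hj, hgcd⟩ := (Nat.dvd_prime_pow Nat.prime_two).1 (Nat.gcd_dvd_right a (2 ^ s))
        have hja : a ≡ 0 [MOD 2 ^ j] :=
          (Nat.modEq_zero_iff_dvd).2 (hgcd ▸ Nat.gcd_dvd_left a (2 ^ s))
        rw [hgcd]
        calc 2 ^ j = if a ≡ 0 [MOD 2 ^ j] then 2 ^ j else 0 := (if_pos hja).symm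
          _ ≤ _ := Finset.single_le_sum
            (f := fun j => if a ≡ 0 [MOD 2 ^ j] then 2 ^ j else 0)
            (fun _ _ => Nat.zero_le _) (Finset.mem_range.2 (Nat.lt_succ_of_le hj))
    _ = ∑ j ∈ Finset.range (s + 1), ∑ a ∈ Finset.range (2 ^ s),
          if a ≡ 0 [MOD 2 ^ j] then 2 ^ j else 0 := Finset.sum_comm
    _ = ∑ j ∈ Finset.range (s + 1), 2 ^ s := by
        refine Finset.sum_congr rfl fun j hj => ?_
        have hjs : j ≤ s := Nat.lt_succ_iff.1 (Finset.mem_range.1 hj)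
        have hdvd : 2 ^ j ∣ 2 ^ s := pow_dvd_pow 2 hjs
        rw [← Finset.sum_filter, Finset.sum_const, smul_eq_mul, ← Nat.count_eq_card_filter_range,
          Nat.count_modEq_card _ (by positivity), Nat.mod_eq_zero_of_dvd hdvd]
        simp [Nat.div_mul_cancel hdvd]
    _ = (s + 1) * 2 ^ s := by simp

/-- For a fixed key `a`, the number of combiners passing the check. -/
theorem card_filter_dvd_sum_sub_le {ι : Type*} [Fintype ι] [DecidableEq ι] (k s : ℕ)
    (e : ι → ℤ) {i : ι} (hi : ¬ (2 : ℤ) ^ k ∣ e i) (y : ℤ) (a : ℕ) :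
    ((Finset.univ : Finset (ι → Fin (2 ^ s))).filter fun χ =>
      (2 : ℤ) ^ (k + s) ∣ (∑ j, (a : ℤ) * e j * ((χ j).val : ℤ)) - y).card
      ≤ a.gcd (2 ^ s) * (2 ^ s) ^ (Fintype.card ι - 1) := by
  have hn : 0 < 2 ^ s := by positivity
  have hg : a.gcd (2 ^ s) ∣ 2 ^ s := Nat.gcd_dvd_right _ _
  let f : (ι → Fin (2 ^ s)) → Fin (a.gcd (2 ^ s)) × ({j // j ≠ i} → Fin (2 ^ s)) := fun χ =>
    (⟨(χ i).val / (2 ^ s / a.gcd (2 ^ s)), Nat.div_lt_of_lt_mul (by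
      rw [Nat.div_mul_cancel hg]; exact (χ i).isLt)⟩, fun j => χ j)
  refine (Finset.card_le_card_of_injOn f (t := Finset.univ) (by simp) ?_).trans_eq ?_
  · intro χ hχ χ' hχ' hf
    simp only [Finset.coe_filter, Finset.mem_univ, true_and, Set.mem_ofPred_eq] at hχ hχ'
    simp only [f, Prod.mk.injEq, Fin.mk.injEq] at hf
    obtain ⟨hdiv, hoff⟩ := hf
    have hne : ∀ j, j ≠ i → χ j = χ' j := fun j hj => congrFun hoff ⟨j, hj⟩
    have hdiff : (2 : ℤ) ^ (k + s) ∣ e i * (a * ((χ i : ℤ) - (χ' i : ℤ))) := by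
      have h := dvd_sub hχ hχ'
      rw [sub_sub_sub_cancel_right, ← Finset.sum_sub_distrib, Finset.sum_eq_single i] at h
      · rwa [show e i * (a * ((χ i : ℤ) - (χ' i : ℤ))) =
          a * e i * (χ i : ℤ) - a * e i * (χ' i : ℤ) by ring]
      · intro j _ hj
        rw [hne j hj, sub_self]
      · simp
    have hi' := Int.prime_two.pow_dvd_of_pow_add_dvd_mul hi hdiff
    funext j
    by_cases hj : j = i
    · subst hj
      exact Fin.ext (eq_of_dvd_mul_sub_of_div_eq hn (by exact_mod_cast hi') hdiv)
    · exact hne j hj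
  · simp [Fintype.card_subtype_compl]

/-- Lemma 2 (SPDZ_{2^k} MAC check bound): if the errors `e i` are not all zero
modulo `2^k`, then for any target `y`, the number of tuples
`(α, χ) ∈ {0,…,2^s−1} × {0,…,2^s−1}^{T3}` with
`∑ i, α * e i * χ i ≡ y (mod 2^(k+s))` is at most `(s+1) * 2^(s*T3)`,
i.e. the probability over uniform `(α, χ)` is at most `(s+1) * 2^(−s)`. -/
theorem lemma2_count (k s T3 : ℕ) (hk : 1 ≤ k) (hs : 1 ≤ s) (hT3 : 1 ≤ T3)
    (e : Fin T3 → ℤ) (he : ∃ i, ¬ ((2 : ℤ) ^ k ∣ e i)) (y : ℤ) :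
    ((Finset.univ : Finset (Fin (2 ^ s) × (Fin T3 → Fin (2 ^ s)))).filter
      (fun t =>
        (2 : ℤ) ^ (k + s) ∣ (∑ i, ((t.1).val : ℤ) * e i * ((t.2 i).val : ℤ)) - y)).card
      ≤ (s + 1) * 2 ^ (s * T3) := by
  obtain ⟨i, hi⟩ := he
  rw [← Finset.univ_product_univ, Finset.card_filter, Finset.sum_product]
  simp only [← Finset.card_filter]
  calc _ ≤ ∑ a : Fin (2 ^ s), (a : ℕ).gcd (2 ^ s) * (2 ^ s) ^ (T3 - 1) :=
        Finset.sum_le_sum fun a _ => by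
          simpa using card_filter_dvd_sum_sub_le k s e hi y a
    _ = (∑ a : Fin (2 ^ s), (a : ℕ).gcd (2 ^ s)) * (2 ^ s) ^ (T3 - 1) :=
        (Finset.sum_mul ..).symm
    _ ≤ (s + 1) * 2 ^ s * (2 ^ s) ^ (T3 - 1) := Nat.mul_le_mul_right _ (sum_gcd_two_pow_le s)
    _ = (s + 1) * 2 ^ (s * T3) := by
        rw [mul_assoc, mul_pow_sub_one (by omega), ← pow_mul]
end

section
/- Let k ≥ 0 and s ≥ 1 be natural numbers, let y be an integer with 0 < y < 2^{k+s}, and let c be any integer. Then the set of χ ∈ {0,…,2^s−1} satisfying 2^{k+2s} ∣ (χ·y − c) has at most one element. -/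
/-- Key step of Lemma 1: for `0 < y < 2^(k+s)` and any integer `c`, there is at
most one `χ ∈ {0,…,2^s−1}` with `χ * y ≡ c (mod 2^(k+2s))`. -/
theorem lemma1_key_step (k s : ℕ) (hs : 1 ≤ s) (y : ℤ)
    (hy0 : 0 < y) (hy1 : y < 2 ^ (k + s)) (c : ℤ) :
    ((Finset.range (2 ^ s)).filter
      (fun χ : ℕ => (2 : ℤ) ^ (k + 2 * s) ∣ ((χ : ℤ) * y - c))).card ≤ 1 := by
  refine Finset.card_le_one.2 fun a ha b hb => ?_
  simp only [Finset.mem_filter, Finset.mem_range] at ha hb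
  have ha' : (a : ℤ) < 2 ^ s := mod_cast ha.1
  have hb' : (b : ℤ) < 2 ^ s := mod_cast hb.1
  have hdvd : (2 : ℤ) ^ (k + 2 * s) ∣ ((a : ℤ) - b) * y := by
    have h := dvd_sub ha.2 hb.2
    rwa [sub_sub_sub_cancel_right, ← sub_mul] at h
  have hdiff : |(a : ℤ) - b| < 2 ^ s := abs_sub_lt_iff.2 ⟨by omega, by omega⟩
  have hlt : |((a : ℤ) - b) * y| < 2 ^ (k + 2 * s) :=
    calc |((a : ℤ) - b) * y| = |(a : ℤ) - b| * y := by rw [abs_mul, abs_of_pos hy0]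
      _ < 2 ^ s * 2 ^ (k + s) := mul_lt_mul'' hdiff hy1 (abs_nonneg _) hy0.le
      _ = 2 ^ (k + 2 * s) := by ring
  have hzero := Int.eq_zero_of_abs_lt_dvd hdvd hlt
  have := (mul_eq_zero.1 hzero).resolve_right hy0.ne'
  omega
end

section
/- Let k ≥ 1, s ≥ 1, T1 ≥ 1, T3 ≥ 1 be natural numbers, and let e : Fin T1 → Fin T3 → ℤ be a fixed matrix of integers such that there exists a row index i₀ with not all e i₀ j zero modulo 2^k (i.e., there exists j with ¬ 2^k ∣ e i₀ j). Then the number of tuples (α, χ) ∈ {0,…,2^s−1} × {0,…,2^s−1}^{T3} satisfying 2^{k+s} ∣ ∑_{j} α · e i j · χ j for every i ∈ Fin T1 is at most (s+1) · 2^{s·T3}. Equivalently, when α and χ_1,…,χ_{T3} are sampled independently and uniformly from {0,…,2^s−1}, the probability that ∑_{j} α·e_{i,j}·χ_j ≡ 0 (mod 2^{k+s}) holds simultaneously for all i is at most (s+1)·2^{−s}. -/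
theorem Prime.pow_dvd_of_pow_add_dvd_mul_s4 {R : Type*} [CommRing R] [IsDomain R] {p : R}
    (hp : Prime p) (k b : ℕ) {m n : R} (hm : ¬ p ^ (k + 1) ∣ m) (h : p ^ (k + b) ∣ m * n) :
    p ^ b ∣ n := by
  induction k generalizing m with
  | zero => exact hp.pow_dvd_of_dvd_mul_left b (by simpa using hm) (by simpa using h)
  | succ k ih =>
    by_cases hpm : p ∣ m
    · obtain ⟨m, rfl⟩ := hpm
      refine ih (m := m) (fun hd => hm ?_) ?_
      · rw [pow_succ']
        exact mul_dvd_mul_left p hd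
      · rw [show k + 1 + b = k + b + 1 by ring, pow_succ', mul_assoc] at h
        exact (mul_dvd_mul_iff_left hp.ne_zero).1 h
    · exact (pow_dvd_pow p (by omega)).trans (hp.pow_dvd_of_dvd_mul_left _ hpm h)

/-- Pairs `(α, χ)` with `2 ^ a ∣ α` and `2 ^ (k + s - a) ∣ ∑ j, c j * χ j` number at most
`2 ^ (s * n)`. The divisibility of the sum is only required for `a < s`. -/
theorem card_filter_dvd_le {k s n a : ℕ} (ha : a ≤ s) (c : Fin n → ℤ) (j₀ : Fin n)
    (hc : ¬ (2 : ℤ) ^ k ∣ c j₀) :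
    ((Finset.univ : Finset (Fin (2 ^ s) × (Fin n → Fin (2 ^ s)))).filter
      (fun t => 2 ^ a ∣ t.1.val ∧
        (a < s → (2 : ℤ) ^ (k + s - a) ∣ ∑ j, c j * ((t.2 j).val : ℤ)))).card
      ≤ 2 ^ (s * n) := by
  have hpow : 2 ^ (s - a) * 2 ^ a = 2 ^ s := by rw [← pow_add]; congr 1; omega
  have hpos : 0 < 2 ^ (s - a) := by positivity
  have hlt (α x : Fin (2 ^ s)) :
      α.val / 2 ^ a + 2 ^ (s - a) * (x.val / 2 ^ (s - a)) < 2 ^ s := by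
    have h1 : α.val / 2 ^ a < 2 ^ (s - a) :=
      Nat.div_lt_of_lt_mul (by rw [mul_comm, hpow]; exact α.isLt)
    have h2 : x.val / 2 ^ (s - a) < 2 ^ a := Nat.div_lt_of_lt_mul (by rw [hpow]; exact x.isLt)
    calc _ < 2 ^ (s - a) * (x.val / 2 ^ (s - a) + 1) := by rw [mul_add]; omega
      _ ≤ 2 ^ (s - a) * 2 ^ a := Nat.mul_le_mul_left _ h2
      _ = _ := hpow
  let f : Fin (2 ^ s) × (Fin n → Fin (2 ^ s)) → (Fin n → Fin (2 ^ s)) := fun t =>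
    Function.update t.2 j₀ ⟨_, hlt t.1 (t.2 j₀)⟩
  have hcard : (Finset.univ : Finset (Fin n → Fin (2 ^ s))).card = 2 ^ (s * n) := by
    simp [pow_mul]
  rw [← hcard]
  refine Finset.card_le_card_of_injOn f (fun _ _ => Finset.mem_coe.2 (Finset.mem_univ _)) ?_
  rintro ⟨α, χ⟩ h1 ⟨β, ψ⟩ h2 hf
  simp only [Finset.coe_filter, Finset.mem_univ, true_and, Set.mem_ofPred_eq] at h1 h2
  obtain ⟨hα, hχ⟩ := h1
  obtain ⟨hβ, hψ⟩ := h2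
  have hne : ∀ j, j ≠ j₀ → χ j = ψ j := fun j hj => by
    simpa [f, hj] using congrFun hf j
  have h0 : α.val / 2 ^ a + 2 ^ (s - a) * (χ j₀ / 2 ^ (s - a)) =
      β.val / 2 ^ a + 2 ^ (s - a) * (ψ j₀ / 2 ^ (s - a)) := by
    simpa [f] using congrFun hf j₀
  have hαlt : α.val / 2 ^ a < 2 ^ (s - a) :=
    Nat.div_lt_of_lt_mul (by rw [mul_comm, hpow]; exact α.isLt)
  have hβlt : β.val / 2 ^ a < 2 ^ (s - a) :=
    Nat.div_lt_of_lt_mul (by rw [mul_comm, hpow]; exact β.isLt)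
  have hmod := congrArg (· % 2 ^ (s - a)) h0
  simp only [Nat.add_mul_mod_self_left, Nat.mod_eq_of_lt hαlt, Nat.mod_eq_of_lt hβlt] at hmod
  have hquot := congrArg (· / 2 ^ (s - a)) h0
  simp only [Nat.add_mul_div_left _ _ hpos, Nat.div_eq_of_lt hαlt, Nat.div_eq_of_lt hβlt,
    zero_add] at hquot
  have hαβ : α = β := Fin.ext (by rw [← Nat.div_mul_cancel hα, hmod, Nat.div_mul_cancel hβ])
  have hdvd : (2 : ℤ) ^ (s - a) ∣ ((ψ j₀).val : ℤ) - (χ j₀).val := by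
    rcases ha.lt_or_eq with has | rfl
    · have hsub := dvd_sub (hψ has) (hχ has)
      rw [← Finset.sum_sub_distrib, Finset.sum_eq_single j₀
        (fun j _ hj => by rw [hne j hj, sub_self]) (by simp), ← mul_sub] at hsub
      obtain _ | k := k
      · simp at hc
      · refine Int.prime_two.pow_dvd_of_pow_add_dvd_mul_s4 k _ hc ((pow_dvd_pow 2 ?_).trans hsub)
        omega
    · simp
  have hrem : (χ j₀).val % 2 ^ (s - a) = (ψ j₀).val % 2 ^ (s - a) :=
    (Nat.modEq_iff_dvd).2 (by exact_mod_cast hdvd)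
  have hval : χ j₀ = ψ j₀ := Fin.ext (by
    rw [← Nat.div_add_mod (χ j₀).val (2 ^ (s - a)), hquot, hrem, Nat.div_add_mod])
  refine Prod.ext hαβ (funext fun j => ?_)
  rcases eq_or_ne j j₀ with rfl | hj
  exacts [hval, hne j hj]

/-- First scenario in the proof of Theorem 1: if some row `i₀` of the error
matrix `e` is not all zero modulo `2^k`, then the number of tuples
`(α, χ) ∈ {0,…,2^s−1} × {0,…,2^s−1}^{T3}` for which
`∑ j, α * e i j * χ j ≡ 0 (mod 2^(k+s))` holds for every row `i` is at most
`(s+1) * 2^(s*T3)`, i.e. the probability is at most `(s+1) * 2^(−s)`. -/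
theorem first_scenario_count (k s T1 T3 : ℕ) (hk : 1 ≤ k) (hs : 1 ≤ s)
    (hT1 : 1 ≤ T1) (hT3 : 1 ≤ T3) (e : Fin T1 → Fin T3 → ℤ)
    (he : ∃ i₀, ∃ j, ¬ ((2 : ℤ) ^ k ∣ e i₀ j)) :
    ((Finset.univ : Finset (Fin (2 ^ s) × (Fin T3 → Fin (2 ^ s)))).filter
      (fun t => ∀ i,
        (2 : ℤ) ^ (k + s) ∣ ∑ j, ((t.1).val : ℤ) * e i j * ((t.2 j).val : ℤ))).card
      ≤ (s + 1) * 2 ^ (s * T3) := by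
  obtain ⟨i₀, j₀, he⟩ := he
  let F (a : ℕ) := (Finset.univ : Finset (Fin (2 ^ s) × (Fin T3 → Fin (2 ^ s)))).filter
    (fun t => 2 ^ a ∣ t.1.val ∧
      (a < s → (2 : ℤ) ^ (k + s - a) ∣ ∑ j, e i₀ j * ((t.2 j).val : ℤ)))
  calc _ ≤ ((Finset.range (s + 1)).biUnion F).card := Finset.card_le_card ?_
    _ ≤ (Finset.range (s + 1)).card * 2 ^ (s * T3) :=
      Finset.card_biUnion_le_card_mul _ _ _ fun a ha =>
        card_filter_dvd_le (Nat.lt_succ_iff.1 (Finset.mem_range.1 ha)) (e i₀) j₀ he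
    _ = _ := by rw [Finset.card_range]
  rintro ⟨α, χ⟩ ht
  have h := (Finset.mem_filter.1 ht).2 i₀
  simp only [mul_assoc, ← Finset.mul_sum] at h
  simp only [Finset.mem_biUnion, Finset.mem_range, F, Finset.mem_filter, Finset.mem_univ, true_and]
  rcases Nat.eq_zero_or_pos α.val with h0 | h0
  · exact ⟨s, by omega, by simp [h0], fun hss => absurd hss (lt_irrefl s)⟩
  · obtain ⟨a, u, hu, hau⟩ := Nat.exists_eq_pow_mul_and_not_dvd h0.ne' 2 (by norm_num)
    have hdvd : 2 ^ a ∣ α.val := ⟨u, hau⟩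
    have has : a < s :=
      (Nat.pow_lt_pow_iff_right one_lt_two).1 ((Nat.le_of_dvd h0 hdvd).trans_lt α.isLt)
    refine ⟨a, by omega, hdvd, fun _ => ?_⟩
    refine Int.prime_two.pow_dvd_of_pow_add_dvd_mul_s4 a _ (m := (α.val : ℤ)) (fun hd => hu ?_) ?_
    · have hd' : 2 ^ (a + 1) ∣ α.val := by exact_mod_cast hd
      rw [hau, pow_succ] at hd'
      exact (Nat.mul_dvd_mul_iff_left (by positivity)).1 hd'
    · rwa [show a + (k + s - a) = k + s by omega]
end
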